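/- A set S of pointed graphs is definable in K^# (i.e., S = ⟦φ⟧ for some K^# formula φ) if and only if S is recognizable by a GNN (i.e., S = ⟦A⟧ for some GNN A). -/

import Mathlib

/-- A labeled directed graph: finite vertex set, directed edges, and a
labeling of each vertex by a valuation over atomic propositions (ℕ). -/
structure PGraph where
  V : Type
  fintV : Fintype V
  decV : DecidableEq V
  E : V → V → Bool
  label : V → ℕ → Bool

attribute [instance] PGraph.fintV PGraph.decV

mutual
/-- Formulas of the logic K^#. -/
inductive KForm : Type where
  | atom : ℕ → KForm
  | neg : KForm → KForm
  | or : KForm → KForm → KForm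
  | geq : KExpr → KForm          -- ξ ≥ 0
/-- Arithmetic expressions of the logic K^#. -/
inductive KExpr : Type where
  | const : ℤ → KExpr
  | one : KForm → KExpr          -- 1_φ
  | count : KForm → KExpr        -- #φ
  | add : KExpr → KExpr → KExpr
  | mul : ℤ → KExpr → KExpr      -- c × ξ
end

mutual
/-- Truth of a K^# formula at a pointed graph. -/
def KForm.eval (G : PGraph) : G.V → KForm → Bool
  | u, .atom p => G.label u p
  | u, .neg φ => !(KForm.eval G u φ)
  | u, .or φ ψ => KForm.eval G u φ || KForm.eval G u ψ
  | u, .geq ξ => decide (0 ≤ KExpr.eval G u ξ)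
/-- Value of a K^# arithmetic expression at a pointed graph. -/
def KExpr.eval (G : PGraph) : G.V → KExpr → ℤ
  | _, .const c => c
  | u, .one φ => if KForm.eval G u φ then 1 else 0
  | u, .count φ =>
      ((Finset.univ.filter (fun v => G.E u v && KForm.eval G v φ = true)).card : ℤ)
  | u, .add ξ ξ' => KExpr.eval G u ξ + KExpr.eval G u ξ'
  | u, .mul c ξ => c * KExpr.eval G u ξ
end

def KForm.satisfiable (φ : KForm) : Prop := ∃ (G : PGraph) (u : G.V), φ.eval G u = true

def KForm.valid (φ : KForm) : Prop := ∀ (G : PGraph) (u : G.V), φ.eval G u = true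

/-- Truncated ReLU. -/
noncomputable def trunc (x : ℝ) : ℝ := max 0 (min 1 x)

/-- A GNN: `L` layers; layer `t` (for `0 ≤ t < L`) has integer matrices
`C t`, `A t` and integer bias `b t`, mapping states of dimension `dim t` to
states of dimension `dim (t+1)`; `a` gives the integer coefficients of the
final linear classification function. The initial dimension `dim 0` is the
number of atomic propositions used. -/
structure GNN where
  L : ℕ
  dim : ℕ → ℕ
  C : (t : ℕ) → Matrix (Fin (dim t)) (Fin (dim (t + 1))) ℤ
  A : (t : ℕ) → Matrix (Fin (dim t)) (Fin (dim (t + 1))) ℤ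
  b : (t : ℕ) → Fin (dim (t + 1)) → ℤ
  a : Fin (dim L) → ℤ

/-- The state of a GNN on a graph after `t` layers. -/
noncomputable def GNN.state (N : GNN) (G : PGraph) : (t : ℕ) → G.V → Fin (N.dim t) → ℝ
  | 0, u, i => if G.label u i then 1 else 0
  | t + 1, u, j => trunc (
      (∑ i, N.state G t u i * (N.C t i j : ℝ)) +
      (∑ i, (∑ v ∈ Finset.univ.filter (fun v => G.E u v = true), N.state G t v i)
            * (N.A t i j : ℝ)) +
      (N.b t j : ℝ))

/-- The GNN accepts a pointed graph iff `cls(x_L(u)) = 1`, i.e. `Σ a_i x_i ≥ 1`. -/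
noncomputable def GNN.accepts (N : GNN) (G : PGraph) (u : G.V) : Prop :=
  1 ≤ ∑ i, (N.a i : ℝ) * N.state G N.L u i

mutual
/-- Modal depth of a K^# formula. -/
def KForm.md : KForm → ℕ
  | .atom _ => 0
  | .neg φ => φ.md
  | .or φ ψ => max φ.md ψ.md
  | .geq ξ => ξ.md
/-- Modal depth of a K^# expression. -/
def KExpr.md : KExpr → ℕ
  | .const _ => 0
  | .one φ => φ.md
  | .count φ => φ.md + 1
  | .add ξ ξ' => max ξ.md ξ'.md
  | .mul _ ξ => ξ.md
end

mutual
/-- Size (number of syntax-tree nodes) of a K^# formula. -/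
def KForm.size : KForm → ℕ
  | .atom _ => 1
  | .neg φ => φ.size + 1
  | .or φ ψ => φ.size + ψ.size + 1
  | .geq ξ => ξ.size + 1
/-- Size (number of syntax-tree nodes) of a K^# expression. -/
def KExpr.size : KExpr → ℕ
  | .const _ => 1
  | .one φ => φ.size + 1
  | .count φ => φ.size + 1
  | .add ξ ξ' => ξ.size + ξ'.size + 1
  | .mul _ ξ => ξ.size + 2
end

mutual
/-- Atomic propositions occurring in a K^# formula. -/
def KForm.atoms : KForm → Finset ℕ
  | .atom p => {p}
  | .neg φ => φ.atoms
  | .or φ ψ => φ.atoms ∪ ψ.atoms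
  | .geq ξ => ξ.atoms
/-- Atomic propositions occurring in a K^# expression. -/
def KExpr.atoms : KExpr → Finset ℕ
  | .const _ => ∅
  | .one φ => φ.atoms
  | .count φ => φ.atoms
  | .add ξ ξ' => ξ.atoms ∪ ξ'.atoms
  | .mul _ ξ => ξ.atoms
end

/-- Conjunction, defined from ¬ and ∨. -/
def KForm.andF (φ ψ : KForm) : KForm := .neg (.or (.neg φ) (.neg ψ))

/-- Implication, defined from ¬ and ∨. -/
def KForm.impF (φ ψ : KForm) : KForm := .or (.neg φ) ψ

/-- Bi-implication, defined from ¬ and ∨. -/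
def KForm.iffF (φ ψ : KForm) : KForm := KForm.andF (φ.impF ψ) (ψ.impF φ)

/-- The modality □φ, abbreviating `0 − #(¬φ) ≥ 0`. -/
def KForm.box (φ : KForm) : KForm :=
  .geq (.add (.const 0) (.mul (-1) (.count (.neg φ))))

/-- `i`-fold iteration □^i of □. -/
def KForm.boxIter : ℕ → KForm → KForm
  | 0, φ => φ
  | i + 1, φ => KForm.box (KForm.boxIter i φ)

/-- The modality `□^{≤m} φ := ⋀_{0 ≤ i ≤ m} □^i φ`. -/
def KForm.boxUpTo : ℕ → KForm → KForm
  | 0, φ => φ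
  | m + 1, φ => KForm.andF (KForm.boxUpTo m φ) (KForm.boxIter (m + 1) φ)

/-- `#ψ = k`, abbreviating `(#ψ − k ≥ 0) ∧ (k − #ψ ≥ 0)`. -/
def KForm.countEq (ψ : KForm) (k : ℤ) : KForm :=
  KForm.andF (.geq (.add (.count ψ) (.const (-k))))
             (.geq (.add (.const k) (.mul (-1) (.count ψ))))

/-- On integers, the truncated ReLU is the indicator of positivity. -/
theorem trunc_intCast (n : ℤ) : trunc (n : ℝ) = if 1 ≤ n then 1 else 0 := by
  unfold trunc
  split_ifs with h
  · have : (1 : ℝ) ≤ n := by exact_mod_cast h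
    rw [min_eq_left this]; norm_num
  · have : (n : ℝ) ≤ 0 := by exact_mod_cast (by omega : n ≤ 0)
    rw [max_eq_left]; exact (min_le_right _ _).trans this

namespace KExpr

/-- The sum of a list of expressions. -/
def listSum (l : List KExpr) : KExpr := l.foldr .add (.const 0)

theorem eval_listSum (G : PGraph) (u : G.V) (l : List KExpr) :
    KExpr.eval G u (listSum l) = (l.map (KExpr.eval G u)).sum := by
  induction l with
  | nil => simp [listSum, KExpr.eval]
  | cons a l ih =>
    have h : listSum (a :: l) = .add a (listSum l) := rfl
    simp [h, KExpr.eval, ih]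

theorem eval_listSum_ofFn (G : PGraph) (u : G.V) {n : ℕ} (f : Fin n → KExpr) :
    KExpr.eval G u (listSum (List.ofFn f)) = ∑ i, KExpr.eval G u (f i) := by
  simp [eval_listSum, List.map_ofFn, List.sum_ofFn]

end KExpr

/-- The number of successors satisfying `φ`, as a sum of indicators. -/
theorem KExpr.eval_count_eq_sum (G : PGraph) (u : G.V) (φ : KForm) :
    ((KExpr.eval G u (.count φ) : ℤ) : ℝ) =
      ∑ v ∈ Finset.univ.filter (fun v => G.E u v = true),
        if KForm.eval G v φ = true then (1 : ℝ) else 0 := by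
  simp [KExpr.eval, Finset.sum_boole, Finset.filter_filter]

namespace GNN

/-- The formula expressing that the `j`-th coordinate of the state after `t` layers is `1`. -/
def stateForm (N : GNN) : (t : ℕ) → Fin (N.dim t) → KForm
  | 0, i => .atom i
  | t + 1, j => .geq (.add
      (.add (KExpr.listSum (List.ofFn fun i => .mul (N.C t i j) (.one (N.stateForm t i))))
        (KExpr.listSum (List.ofFn fun i => .mul (N.A t i j) (.count (N.stateForm t i)))))
      (.const (N.b t j - 1)))

/-- The formula expressing acceptance. -/
def acceptForm (N : GNN) : KForm :=
  .geq (.add (KExpr.listSum (List.ofFn fun i => .mul (N.a i) (.one (N.stateForm N.L i))))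
    (.const (-1)))

theorem state_eq_eval_stateForm (N : GNN) (G : PGraph) (t : ℕ) (u : G.V) (j : Fin (N.dim t)) :
    N.state G t u j = if KForm.eval G u (N.stateForm t j) = true then 1 else 0 := by
  induction t generalizing u with
  | zero => simp [state, stateForm, KForm.eval]
  | succ t ih =>
    have key : (∑ i, N.state G t u i * (N.C t i j : ℝ)) +
        (∑ i, (∑ v ∈ Finset.univ.filter (fun v => G.E u v = true), N.state G t v i)
          * (N.A t i j : ℝ)) + (N.b t j : ℝ) =
        (((∑ i, N.C t i j * KExpr.eval G u (.one (N.stateForm t i))) +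
          (∑ i, N.A t i j * KExpr.eval G u (.count (N.stateForm t i))) + N.b t j : ℤ) : ℝ) := by
      simp only [Int.cast_add, Int.cast_sum, Int.cast_mul, KExpr.eval_count_eq_sum, ih]
      simp [KExpr.eval, mul_comm]
    rw [state, key, trunc_intCast]
    refine if_congr ?_ rfl rfl
    simp only [stateForm, KForm.eval, decide_eq_true_eq]
    simp only [KExpr.eval, KExpr.eval_listSum_ofFn]
    omega

theorem eval_acceptForm (N : GNN) (G : PGraph) (u : G.V) :
    KForm.eval G u N.acceptForm = true ↔ N.accepts G u := by
  have key : ∑ i, (N.a i : ℝ) * N.state G N.L u i =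
      ((∑ i, N.a i * KExpr.eval G u (.one (N.stateForm N.L i)) : ℤ) : ℝ) := by
    simp [state_eq_eval_stateForm, KExpr.eval]
  rw [accepts, key, ← Int.cast_one, Int.cast_le, acceptForm, KForm.eval, decide_eq_true_eq,
    KExpr.eval, KExpr.eval_listSum_ofFn]
  simp only [KExpr.eval]
  omega

end GNN

open scoped Classical in
mutual
/-- The finite set of subformulas of a formula. -/
noncomputable def KForm.sub : KForm → Finset KForm
  | .atom p => {.atom p}
  | .neg φ => insert (.neg φ) φ.sub
  | .or φ ψ => insert (.or φ ψ) (φ.sub ∪ ψ.sub)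
  | .geq ξ => insert (.geq ξ) ξ.sub
/-- The finite set of subformulas of an expression. -/
noncomputable def KExpr.sub : KExpr → Finset KForm
  | .const _ => ∅
  | .one φ => φ.sub
  | .count φ => φ.sub
  | .add ξ ξ' => ξ.sub ∪ ξ'.sub
  | .mul _ ξ => ξ.sub
end

theorem KForm.self_mem_sub (φ : KForm) : φ ∈ φ.sub := by
  cases φ <;> simp [KForm.sub]

open scoped Classical in
/-- The coefficients of the indicators `1_φ` in an expression. -/
noncomputable def KExpr.coeffOne : KExpr → KForm → ℤ
  | .const _ => 0
  | .one φ => Pi.single φ 1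
  | .count _ => 0
  | .add ξ ξ' => ξ.coeffOne + ξ'.coeffOne
  | .mul c ξ => c • ξ.coeffOne

open scoped Classical in
/-- The coefficients of the counts `#φ` in an expression. -/
noncomputable def KExpr.coeffCount : KExpr → KForm → ℤ
  | .const _ => 0
  | .one _ => 0
  | .count φ => Pi.single φ 1
  | .add ξ ξ' => ξ.coeffCount + ξ'.coeffCount
  | .mul c ξ => c • ξ.coeffCount

/-- The constant term of an expression. -/
def KExpr.coeffConst : KExpr → ℤ
  | .const c => c
  | .one _ => 0
  | .count _ => 0
  | .add ξ ξ' => ξ.coeffConst + ξ'.coeffConst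
  | .mul c ξ => c * ξ.coeffConst

/-- An expression which, whenever `φ` is true, is at least `1`, and otherwise is at most `0`,
built from the immediate subformulas of `φ`. -/
def KForm.toExpr : KForm → KExpr
  | .atom p => .one (.atom p)
  | .neg φ => .add (.const 1) (.mul (-1) (.one φ))
  | .or φ ψ => .add (.one φ) (.one ψ)
  | .geq ξ => .add ξ (.const 1)

theorem KForm.one_le_eval_toExpr (G : PGraph) (u : G.V) (φ : KForm) :
    1 ≤ KExpr.eval G u φ.toExpr ↔ KForm.eval G u φ = true := by
  cases φ with
  | atom p => simp only [KForm.toExpr, KExpr.eval]; split_ifs with h <;> simp [h]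
  | neg φ => simp only [KForm.toExpr, KExpr.eval, KForm.eval]; split_ifs with h <;> simp [h]
  | or φ ψ =>
    simp only [KForm.toExpr, KExpr.eval, KForm.eval]
    split_ifs with h h' h' <;> simp [h, h']
  | geq ξ => simp [KForm.toExpr, KExpr.eval, KForm.eval]

/-- The GNN with `n + 1` layers over the list `e` of formulas, each layer of which after the first
evaluates every formula from the values of its immediate subformulas; `a` is the classification
vector. -/
noncomputable def evalGNN (k m : ℕ) (e : Fin m → KForm) (n : ℕ) (a : Fin m → ℤ) : GNN where
  L := n + 1
  dim | 0 => k | _ + 1 => m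
  C | 0 => fun i j => KExpr.coeffOne (.one (.atom i)) (e j)
    | _ + 1 => fun i j => (e j).toExpr.coeffOne (e i)
  A | 0 => 0
    | _ + 1 => fun i j => (e j).toExpr.coeffCount (e i)
  b | 0 => 0
    | _ + 1 => fun j => (e j).toExpr.coeffConst
  a := a

section evalGNN

variable {k m : ℕ} {e : Fin m → KForm} {n : ℕ} {a : Fin m → ℤ}

variable (k e n a) in
/-- The state of `evalGNN` after `t + 1` layers. -/
noncomputable def evalState (G : PGraph) (t : ℕ) : G.V → Fin m → ℝ :=
  (evalGNN k m e n a).state G (t + 1)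

theorem evalState_zero {p : ℕ} (hp : p < k) {j : Fin m} (hj : e j = .atom p)
    (G : PGraph) (u : G.V) :
    evalState k e n a G 0 u j = if G.label u p = true then 1 else 0 := by
  have h : evalState k e n a G 0 u j = trunc (
      (∑ i : Fin k, (if G.label u i = true then (1 : ℝ) else 0) *
        (((KExpr.one (.atom i)).coeffOne (e j) : ℤ) : ℝ)) +
      (∑ i : Fin k, (∑ v ∈ Finset.univ.filter (fun v => G.E u v = true),
        (if G.label v i = true then (1 : ℝ) else 0)) * ((0 : ℤ) : ℝ)) + ((0 : ℤ) : ℝ)) := rfl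
  have h1 : ∀ i : Fin k, (KExpr.one (.atom i)).coeffOne (e j) = if i = ⟨p, hp⟩ then 1 else 0 := by
    intro i
    simp [KExpr.coeffOne, hj, Pi.single_apply, Fin.ext_iff, eq_comm]
  have h2 : ∑ i : Fin k, (if G.label u i = true then (1 : ℝ) else 0) *
      (((KExpr.one (.atom i)).coeffOne (e j) : ℤ) : ℝ) =
      ((if G.label u p = true then 1 else 0 : ℤ) : ℝ) := by
    simp [h1]
  rw [h, h2]
  simp only [Int.cast_zero, mul_zero, Finset.sum_const_zero, add_zero]
  rw [trunc_intCast]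
  split_ifs <;> simp_all

/-- The real number an expression takes when the truth value of `e i` at `v` is replaced
by `x v i`. -/
noncomputable def KExpr.linEval (G : PGraph) (e : Fin m → KForm) (x : G.V → Fin m → ℝ) (u : G.V)
    (ξ : KExpr) : ℝ :=
  (∑ i, x u i * (ξ.coeffOne (e i) : ℝ)) +
  (∑ i, (∑ v ∈ Finset.univ.filter (fun v => G.E u v = true), x v i) *
    (ξ.coeffCount (e i) : ℝ)) + (ξ.coeffConst : ℝ)

theorem evalState_succ (G : PGraph) (t : ℕ) (u : G.V) (j : Fin m) :
    evalState k e n a G (t + 1) u j =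
      trunc ((e j).toExpr.linEval G e (evalState k e n a G t) u) := rfl

theorem sum_mul_single (he : Function.Injective e) (y : Fin m → ℝ) (j : Fin m) [DecidableEq KForm] :
    ∑ i, y i * ((Pi.single (e j) 1 : KForm → ℤ) (e i) : ℝ) = y j := by
  simp [Pi.single_apply, he.eq_iff]

variable {G : PGraph} {x : G.V → Fin m → ℝ} {u : G.V}

theorem KExpr.linEval_const (c : ℤ) : (KExpr.const c).linEval G e x u = c := by
  simp [linEval, coeffOne, coeffCount, coeffConst]

theorem KExpr.linEval_one (he : Function.Injective e) {φ : KForm} {j : Fin m} (hj : e j = φ) :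
    (KExpr.one φ).linEval G e x u = x u j := by
  subst hj
  simp [linEval, coeffOne, coeffCount, coeffConst, sum_mul_single he]

theorem KExpr.linEval_count (he : Function.Injective e) {φ : KForm} {j : Fin m} (hj : e j = φ) :
    (KExpr.count φ).linEval G e x u =
      ∑ v ∈ Finset.univ.filter (fun v => G.E u v = true), x v j := by
  subst hj
  simp [linEval, coeffOne, coeffCount, coeffConst, sum_mul_single he]

theorem KExpr.linEval_add (ξ ξ' : KExpr) :
    (KExpr.add ξ ξ').linEval G e x u = ξ.linEval G e x u + ξ'.linEval G e x u := by
  simp only [linEval, coeffOne, coeffCount, coeffConst, Pi.add_apply, Int.cast_add, mul_add,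
    Finset.sum_add_distrib]
  ring

theorem KExpr.linEval_mul (c : ℤ) (ξ : KExpr) :
    (KExpr.mul c ξ).linEval G e x u = c * ξ.linEval G e x u := by
  simp only [linEval, coeffOne, coeffCount, coeffConst, Pi.smul_apply, smul_eq_mul, Int.cast_mul,
    mul_add, Finset.mul_sum, mul_left_comm]

theorem evalState_of_linEval {t : ℕ} {j : Fin m}
    (h : (e j).toExpr.linEval G e (evalState k e n a G t) u =
      KExpr.eval G u (e j).toExpr) :
    evalState k e n a G (t + 1) u j =
      if KForm.eval G u (e j) = true then 1 else 0 := by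
  rw [evalState_succ, h, trunc_intCast]
  exact if_congr (KForm.one_le_eval_toExpr _ _ _) rfl rfl

theorem linEval_one_eq_eval (he : Function.Injective e) {φ : KForm} {j : Fin m} (hj : e j = φ)
    (h : x u j = if KForm.eval G u φ = true then 1 else 0) :
    (KExpr.one φ).linEval G e x u = KExpr.eval G u (.one φ) := by
  rw [KExpr.linEval_one he hj, h]
  simp [KExpr.eval]

mutual
/-- After as many layers as the size of `φ`, the coordinate of `φ` holds its truth value. -/
theorem evalState_eq (he : Function.Injective e) (hk : ∀ p j, e j = .atom p → p < k)
    (φ : KForm) (hs : ∀ ψ ∈ φ.sub, ∃ i, e i = ψ) (t : ℕ) (ht : φ.size ≤ t + 1)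
    (u : G.V) (j : Fin m) (hj : e j = φ) :
    evalState k e n a G t u j = if KForm.eval G u φ = true then 1 else 0 := by
  match φ with
  | .atom p =>
    induction t with
    | zero =>
      exact (evalState_zero (hk p j hj) hj G u).trans (if_congr (by simp [KForm.eval]) rfl rfl)
    | succ t ih =>
      rw [evalState_of_linEval, hj]
      rw [hj]
      exact linEval_one_eq_eval he hj (ih (by simp [KForm.size]))
  | .neg φ =>
    simp only [KForm.size] at ht
    have hφ : 0 < φ.size := by cases φ <;> simp [KForm.size]
    obtain ⟨t, rfl⟩ : ∃ s, t = s + 1 := ⟨t - 1, by omega⟩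
    have hs' : ∀ ψ ∈ φ.sub, ∃ i, e i = ψ := fun ψ h => hs ψ (by simp [KForm.sub, h])
    obtain ⟨i, hi⟩ := hs' φ φ.self_mem_sub
    rw [evalState_of_linEval, hj]
    rw [hj, KForm.toExpr, KExpr.linEval_add, KExpr.linEval_mul, KExpr.linEval_const,
      linEval_one_eq_eval he hi (evalState_eq he hk φ hs' t (by omega) u i hi)]
    simp [KExpr.eval]
  | .or φ ψ =>
    simp only [KForm.size] at ht
    have hφ : 0 < φ.size := by cases φ <;> simp [KForm.size]
    obtain ⟨t, rfl⟩ : ∃ s, t = s + 1 := ⟨t - 1, by omega⟩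
    have hs₁ : ∀ χ ∈ φ.sub, ∃ i, e i = χ := fun χ h => hs χ (by simp [KForm.sub, h])
    have hs₂ : ∀ χ ∈ ψ.sub, ∃ i, e i = χ := fun χ h => hs χ (by simp [KForm.sub, h])
    obtain ⟨i₁, hi₁⟩ := hs₁ φ φ.self_mem_sub
    obtain ⟨i₂, hi₂⟩ := hs₂ ψ ψ.self_mem_sub
    rw [evalState_of_linEval, hj]
    rw [hj, KForm.toExpr, KExpr.linEval_add,
      linEval_one_eq_eval he hi₁ (evalState_eq he hk φ hs₁ t (by omega) u i₁ hi₁),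
      linEval_one_eq_eval he hi₂ (evalState_eq he hk ψ hs₂ t (by omega) u i₂ hi₂)]
    simp [KExpr.eval]
  | .geq ξ =>
    simp only [KForm.size] at ht
    have hξ : 0 < ξ.size := by cases ξ <;> simp [KExpr.size]
    obtain ⟨t, rfl⟩ : ∃ s, t = s + 1 := ⟨t - 1, by omega⟩
    have hs' : ∀ ψ ∈ ξ.sub, ∃ i, e i = ψ := fun ψ h => hs ψ (by simp [KForm.sub, h])
    rw [evalState_of_linEval, hj]
    rw [hj, KForm.toExpr, KExpr.linEval_add, KExpr.linEval_const,
      evalState_linEval_eq he hk ξ hs' t (by omega) u]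
    simp [KExpr.eval]
/-- After as many layers as the size of `ξ`, the states determine the value of `ξ`. -/
theorem evalState_linEval_eq (he : Function.Injective e) (hk : ∀ p j, e j = .atom p → p < k)
    (ξ : KExpr) (hs : ∀ ψ ∈ ξ.sub, ∃ i, e i = ψ) (t : ℕ) (ht : ξ.size ≤ t + 1) (u : G.V) :
    ξ.linEval G e (evalState k e n a G t) u = KExpr.eval G u ξ := by
  match ξ with
  | .const c => simp [KExpr.linEval_const, KExpr.eval]
  | .one φ =>
    simp only [KExpr.size] at ht
    simp only [KExpr.sub] at hs
    obtain ⟨i, hi⟩ := hs φ φ.self_mem_sub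
    exact linEval_one_eq_eval he hi (evalState_eq he hk φ hs t (by omega) u i hi)
  | .count φ =>
    simp only [KExpr.size] at ht
    simp only [KExpr.sub] at hs
    obtain ⟨i, hi⟩ := hs φ φ.self_mem_sub
    rw [KExpr.linEval_count he hi, KExpr.eval_count_eq_sum]
    exact Finset.sum_congr rfl fun v _ => evalState_eq he hk φ hs t (by omega) v i hi
  | .add ξ ξ' =>
    simp only [KExpr.size] at ht
    have hs₁ : ∀ χ ∈ ξ.sub, ∃ i, e i = χ := fun χ h => hs χ (by simp [KExpr.sub, h])
    have hs₂ : ∀ χ ∈ ξ'.sub, ∃ i, e i = χ := fun χ h => hs χ (by simp [KExpr.sub, h])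
    rw [KExpr.linEval_add, evalState_linEval_eq he hk ξ hs₁ t (by omega) u,
      evalState_linEval_eq he hk ξ' hs₂ t (by omega) u]
    simp [KExpr.eval]
  | .mul c ξ =>
    simp only [KExpr.size] at ht
    simp only [KExpr.sub] at hs
    rw [KExpr.linEval_mul, evalState_linEval_eq he hk ξ hs t (by omega) u]
    simp [KExpr.eval]
end

end evalGNN

/-- Every formula is recognized by a GNN. -/
theorem KForm.exists_accepts_iff (φ : KForm) :
    ∃ N : GNN, ∀ (G : PGraph) (u : G.V), N.accepts G u ↔ KForm.eval G u φ = true := by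
  let e : Fin φ.sub.card → KForm := fun i => (φ.sub.equivFin.symm i : KForm)
  have he : Function.Injective e := Subtype.val_injective.comp φ.sub.equivFin.symm.injective
  have hs : ∀ ψ ∈ φ.sub, ∃ i, e i = ψ := fun ψ h => ⟨φ.sub.equivFin ⟨ψ, h⟩, by simp [e]⟩
  let bound : KForm → ℕ := fun | .atom p => p + 1 | _ => 0
  have hk : ∀ p j, e j = .atom p → p < φ.sub.sup bound := fun p j hj =>
    Finset.le_sup (f := bound) (hj ▸ (φ.sub.equivFin.symm j).2 : KForm.atom p ∈ φ.sub)
  obtain ⟨j, hj⟩ := hs φ φ.self_mem_sub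
  refine ⟨evalGNN (φ.sub.sup bound) φ.sub.card e φ.size (Pi.single j 1), fun G u => ?_⟩
  have h : (evalGNN (φ.sub.sup bound) φ.sub.card e φ.size (Pi.single j 1)).accepts G u ↔
      1 ≤ ∑ i : Fin φ.sub.card, ((Pi.single j 1 : Fin φ.sub.card → ℤ) i : ℝ) *
        evalState (φ.sub.sup bound) e φ.size (Pi.single j 1) G φ.size u i := Iff.rfl
  rw [h, Finset.sum_eq_single j (fun i _ hi => by simp [hi]) (by simp),
    evalState_eq he hk φ hs φ.size (by omega) u j hj]
  split_ifs with h <;> simp [h]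

/-- A set of pointed graphs is definable by a K^# formula iff it
is recognizable by a GNN. -/
theorem definable_iff_recognizable (S : Set ((G : PGraph) × G.V)) :
    (∃ φ : KForm, S = {pg | KForm.eval pg.1 pg.2 φ = true}) ↔
    (∃ N : GNN, S = {pg | N.accepts pg.1 pg.2}) := by
  constructor
  · rintro ⟨φ, rfl⟩
    obtain ⟨N, hN⟩ := φ.exists_accepts_iff
    exact ⟨N, Set.ext fun pg => (hN pg.1 pg.2).symm⟩
  · rintro ⟨N, rfl⟩
    exact ⟨N.acceptForm, Set.ext fun pg => (N.eval_acceptForm pg.1 pg.2).symm⟩
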